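/- Let Z be a nonempty finite type, let α > 0 be a real number, and let p₁, p₂ be probability mass functions on Z with p₁(z) > 0 and p₂(z) > 0 for all z. Define Z_α = ∑_z p₁(z)^{1/(α+1)} · p₂(z)^{α/(α+1)} and q_α(z) = p₁(z)^{1/(α+1)} · p₂(z)^{α/(α+1)} / Z_α. If a probability mass function q on Z satisfies KL(q ‖ p₁) + α · KL(q ‖ p₂) = KL(q_α ‖ p₁) + α · KL(q_α ‖ p₂), then q = q_α; that is, the minimizer of the objective is unique. -/

import Mathlib

open Real BigOperators Finset

/-- Kullback–Leibler divergence between probability mass functions on a finite type,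
with the summand taken to be `0` whenever `q z = 0`. -/
noncomputable def KLfin {Z : Type*} [Fintype Z] (q p : Z → ℝ) : ℝ :=
  ∑ z, if q z = 0 then 0 else q z * Real.log (q z / p z)

theorem KLfin_self {Z : Type*} [Fintype Z] (p : Z → ℝ) : KLfin p p = 0 := by
  refine Finset.sum_eq_zero fun z _ => ?_
  split_ifs with h
  · rfl
  · rw [div_self h, Real.log_one, mul_zero]

/-- Equality case of Gibbs' inequality. -/
theorem eq_of_KLfin_eq_zero {Z : Type*} [Fintype Z] {q p : Z → ℝ}
    (hq : ∀ z, 0 ≤ q z) (hp : ∀ z, 0 < p z) (hsum : ∑ z, q z = ∑ z, p z)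
    (h : KLfin q p = 0) : q = p := by
  have key : ∑ z, p z * InformationTheory.klFun (q z / p z) = KLfin q p := by
    have hterm : ∀ z, p z * InformationTheory.klFun (q z / p z) =
        (if q z = 0 then 0 else q z * Real.log (q z / p z)) + (p z - q z) := by
      intro z
      have hpz := (hp z).ne'
      unfold InformationTheory.klFun
      split_ifs with hz
      · simp [hz]
      · field_simp
        ring
    simp only [hterm, Finset.sum_add_distrib, Finset.sum_sub_distrib, hsum, sub_self, add_zero,
      KLfin]
  have hnonneg : ∀ z ∈ Finset.univ, 0 ≤ p z * InformationTheory.klFun (q z / p z) :=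
    fun z _ => mul_nonneg (hp z).le
      (InformationTheory.klFun_nonneg (div_nonneg (hq z) (hp z).le))
  funext z
  have hz := (Finset.sum_eq_zero_iff_of_nonneg hnonneg).mp (key.trans h) z (Finset.mem_univ z)
  have hk := (mul_eq_zero.mp hz).resolve_left (hp z).ne'
  rw [InformationTheory.klFun_eq_zero_iff (div_nonneg (hq z) (hp z).le)] at hk
  exact (div_eq_one_iff_eq (hp z).ne').mp hk

/-- The weighted objective equals a single divergence from the normalized geometric mean,
up to an additive constant. -/
theorem KLfin_add_mul_KLfin {Z : Type*} [Fintype Z] {α c : ℝ} (hα : 0 < α) (hc : 0 < c)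
    {p₁ p₂ r q : Z → ℝ} (hp₁ : ∀ z, 0 < p₁ z) (hp₂ : ∀ z, 0 < p₂ z)
    (hr : ∀ z, r z = p₁ z ^ (1 / (α + 1)) * p₂ z ^ (α / (α + 1)) / c)
    (hq : ∑ z, q z = 1) :
    KLfin q p₁ + α * KLfin q p₂ = (α + 1) * KLfin q r - (α + 1) * Real.log c := by
  have hc_sum : (α + 1) * Real.log c = ∑ z, q z * ((α + 1) * Real.log c) := by
    rw [← Finset.sum_mul, hq, one_mul]
  rw [hc_sum]
  unfold KLfin
  rw [Finset.mul_sum, Finset.mul_sum, ← Finset.sum_add_distrib, ← Finset.sum_sub_distrib]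
  refine Finset.sum_congr rfl fun z _ => ?_
  split_ifs with hz
  · simp [hz]
  · have h₁ := Real.rpow_pos_of_pos (hp₁ z) (1 / (α + 1))
    have h₂ := Real.rpow_pos_of_pos (hp₂ z) (α / (α + 1))
    have hrz : r z ≠ 0 := by
      rw [hr]
      positivity
    rw [Real.log_div hz (hp₁ z).ne', Real.log_div hz (hp₂ z).ne', Real.log_div hz hrz, hr,
      Real.log_div (mul_pos h₁ h₂).ne' hc.ne', Real.log_mul h₁.ne' h₂.ne',
      Real.log_rpow (hp₁ z), Real.log_rpow (hp₂ z)]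
    field_simp
    ring

/-- Uniqueness of the minimizer: if a probability mass function `q` attains the minimum
value of `q ↦ KL(q ‖ p₁) + α · KL(q ‖ p₂)`, then `q = q_α`. -/
theorem weighted_KL_minimizer_unique
    {Z : Type*} [Fintype Z] [Nonempty Z] (α : ℝ) (hα : 0 < α)
    (p₁ p₂ : Z → ℝ) (hp₁ : ∀ z, 0 < p₁ z) (hp₂ : ∀ z, 0 < p₂ z)
    (hs₁ : ∑ z, p₁ z = 1) (hs₂ : ∑ z, p₂ z = 1)
    (Zα : ℝ) (hZα : Zα = ∑ z, p₁ z ^ (1 / (α + 1)) * p₂ z ^ (α / (α + 1)))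
    (qα : Z → ℝ)
    (hqα : ∀ z, qα z = p₁ z ^ (1 / (α + 1)) * p₂ z ^ (α / (α + 1)) / Zα)
    (q : Z → ℝ) (hq0 : ∀ z, 0 ≤ q z) (hq1 : ∑ z, q z = 1)
    (heq : KLfin q p₁ + α * KLfin q p₂ = KLfin qα p₁ + α * KLfin qα p₂) :
    q = qα := by
  have hw : ∀ z, 0 < p₁ z ^ (1 / (α + 1)) * p₂ z ^ (α / (α + 1)) := fun z =>
    mul_pos (Real.rpow_pos_of_pos (hp₁ z) _) (Real.rpow_pos_of_pos (hp₂ z) _)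
  have hZpos : 0 < Zα := by
    rw [hZα]
    exact Finset.sum_pos (fun z _ => hw z) Finset.univ_nonempty
  have hqα_pos : ∀ z, 0 < qα z := fun z => by
    rw [hqα]
    exact div_pos (hw z) hZpos
  have hqα_sum : ∑ z, qα z = 1 := by
    simp only [hqα]
    rw [← Finset.sum_div, ← hZα, div_self hZpos.ne']
  rw [KLfin_add_mul_KLfin hα hZpos hp₁ hp₂ hqα hq1,
    KLfin_add_mul_KLfin hα hZpos hp₁ hp₂ hqα hqα_sum, KLfin_self] at heq
  refine eq_of_KLfin_eq_zero hq0 hqα_pos (hq1.trans hqα_sum.symm) ?_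
  have hα1 : α + 1 ≠ 0 := by positivity
  exact mul_left_cancel₀ hα1 (sub_left_injective heq)
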